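/- Let A be an n × n real random matrix with arbitrary distribution, let M ≥ 1, δ ∈ (0, 1/2), p₀ ∈ (0,1), and m ∈ {1,…,n}. Assume that for every subset I ⊆ {1,…,n} with |I| = m and every λ₀ ∈ ℝ with |λ₀| ≤ M·√n, the probability that s_min((A − λ₀·Id)_{I^c}) ≤ 6·δ·M·√n and ‖A‖ ≤ M·√n is at most p₀. Then the probability that both ‖A‖ ≤ M·√n and there exist an eigenvector v ∈ ℝⁿ of A with ‖v‖₂ = 1 and a subset I ⊆ {1,…,n} with |I| = m and ‖v_I‖₂ < δ, is at most (3/δ)·(n·e/m)^m · p₀. -/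

import Mathlib

open MeasureTheory ProbabilityTheory Matrix

/-- The Euclidean (ℓ²) norm of a real vector. -/
noncomputable def norm2R {ι : Type*} [Fintype ι] (v : ι → ℝ) : ℝ :=
  Real.sqrt (∑ i, (v i) ^ 2)

/-- The Euclidean norm of the subvector `v_I`. -/
noncomputable def norm2ROn {ι : Type*} (v : ι → ℝ) (I : Finset ι) : ℝ :=
  Real.sqrt (∑ i ∈ I, (v i) ^ 2)

/-- The smallest singular value of a real matrix: the infimum of `‖Mx‖₂`
over unit vectors `x`. -/
noncomputable def sMinR {ι κ : Type*} [Fintype ι] [Fintype κ] (M : Matrix ι κ ℝ) : ℝ :=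
  sInf {r : ℝ | ∃ x : κ → ℝ, norm2R x = 1 ∧ r = norm2R (M *ᵥ x)}

/-- The operator (spectral) norm of a real matrix: the supremum of `‖Mx‖₂`
over unit vectors `x`. -/
noncomputable def opNormR {ι κ : Type*} [Fintype ι] [Fintype κ] (M : Matrix ι κ ℝ) : ℝ :=
  sSup {r : ℝ | ∃ x : κ → ℝ, norm2R x = 1 ∧ r = norm2R (M *ᵥ x)}

/-- For an `n × n` real matrix `A` and `λ₀ ∈ ℝ`, the matrix `A - λ₀·Id`. -/
noncomputable def shiftMatrixR {n : ℕ} (A : Matrix (Fin n) (Fin n) ℝ) (l : ℝ) :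
    Matrix (Fin n) (Fin n) ℝ :=
  Matrix.of fun i j => A i j - l * (if i = j then 1 else 0)

/-- `norm2R` is the norm of `EuclideanSpace`. -/
lemma norm2R_eq_norm_toLp {ι : Type*} [Fintype ι] (v : ι → ℝ) :
    norm2R v = ‖WithLp.toLp 2 v‖ := by
  simp [norm2R, EuclideanSpace.norm_eq]

lemma norm2R_nonneg {ι : Type*} [Fintype ι] (v : ι → ℝ) : 0 ≤ norm2R v :=
  Real.sqrt_nonneg _

lemma norm2R_add_le {ι : Type*} [Fintype ι] (v w : ι → ℝ) :
    norm2R (v + w) ≤ norm2R v + norm2R w := by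
  simpa only [norm2R_eq_norm_toLp, WithLp.toLp_add] using norm_add_le _ _

lemma norm2R_smul {ι : Type*} [Fintype ι] (c : ℝ) (v : ι → ℝ) :
    norm2R (c • v) = |c| * norm2R v := by
  simp only [norm2R_eq_norm_toLp, WithLp.toLp_smul, norm_smul, Real.norm_eq_abs]

lemma norm2R_eq_zero {ι : Type*} [Fintype ι] {v : ι → ℝ} : norm2R v = 0 ↔ v = 0 := by
  rw [norm2R_eq_norm_toLp, norm_eq_zero, WithLp.toLp_eq_zero]

lemma norm2R_inv_smul_self {ι : Type*} [Fintype ι] {v : ι → ℝ} (hv : norm2R v ≠ 0) :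
    norm2R ((norm2R v)⁻¹ • v) = 1 := by
  rw [norm2R_smul, abs_of_nonneg (inv_nonneg.2 (norm2R_nonneg v)), inv_mul_cancel₀ hv]

lemma norm2R_mulVec_inv_smul_self {ι κ : Type*} [Fintype ι] [Fintype κ]
    (B : Matrix ι κ ℝ) (x : κ → ℝ) :
    norm2R (B *ᵥ ((norm2R x)⁻¹ • x)) = norm2R (B *ᵥ x) / norm2R x := by
  rw [mulVec_smul, norm2R_smul, abs_of_nonneg (inv_nonneg.2 (norm2R_nonneg x)), div_eq_inv_mul]

lemma norm2R_mulVec_le_opNormR_mul {ι κ : Type*} [Fintype ι] [Fintype κ]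
    (B : Matrix ι κ ℝ) (x : κ → ℝ) : norm2R (B *ᵥ x) ≤ opNormR B * norm2R x := by
  classical
  obtain hx | hx := (norm2R_nonneg x).eq_or_lt'
  · simp [norm2R_eq_zero.1 hx, norm2R]
  have hbdd : BddAbove {r : ℝ | ∃ x : κ → ℝ, norm2R x = 1 ∧ r = norm2R (B *ᵥ x)} := by
    refine ⟨‖LinearMap.toContinuousLinearMap (B.toEuclideanLin (𝕜 := ℝ))‖, ?_⟩
    rintro _ ⟨y, hy, rfl⟩
    have := (LinearMap.toContinuousLinearMap (B.toEuclideanLin (𝕜 := ℝ))).le_opNorm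
      (WithLp.toLp 2 y)
    rwa [LinearMap.coe_toContinuousLinearMap', Matrix.toLpLin_toLp, ← norm2R_eq_norm_toLp,
      ← norm2R_eq_norm_toLp, hy, mul_one] at this
  rw [← div_le_iff₀ hx, ← norm2R_mulVec_inv_smul_self]
  exact le_csSup hbdd ⟨_, norm2R_inv_smul_self hx.ne', rfl⟩

lemma sMinR_mul_norm2R_le {ι κ : Type*} [Fintype ι] [Fintype κ]
    (B : Matrix ι κ ℝ) (x : κ → ℝ) : sMinR B * norm2R x ≤ norm2R (B *ᵥ x) := by
  obtain hx | hx := (norm2R_nonneg x).eq_or_lt'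
  · simpa [hx] using norm2R_nonneg _
  rw [← le_div_iff₀ hx, ← norm2R_mulVec_inv_smul_self]
  refine csInf_le ⟨0, ?_⟩ ⟨_, norm2R_inv_smul_self hx.ne', rfl⟩
  rintro _ ⟨y, -, rfl⟩
  exact norm2R_nonneg _

lemma norm2R_indicator {ι : Type*} [Fintype ι] (v : ι → ℝ) (I : Finset ι) :
    norm2R ((I : Set ι).indicator v) = norm2ROn v I := by
  classical
  simp [norm2R, norm2ROn, Set.indicator_apply, ite_pow, Finset.sum_ite_mem]

lemma norm2R_comp_coe {ι : Type*} (v : ι → ℝ) (I : Finset ι) :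
    norm2R (fun j : {j // j ∈ I} => v j) = norm2ROn v I := by
  simp only [norm2R, norm2ROn]
  rw [Finset.sum_coe_sort I (fun i => v i ^ 2)]

lemma shiftMatrixR_mulVec {n : ℕ} (B : Matrix (Fin n) (Fin n) ℝ) (l : ℝ) (x : Fin n → ℝ) :
    shiftMatrixR B l *ᵥ x = B *ᵥ x - l • x := by
  ext i
  simp [shiftMatrixR, mulVec, dotProduct, sub_mul, Finset.sum_sub_distrib]

lemma submatrix_coe_mulVec {ι κ : Type*} [Fintype κ]
    (B : Matrix ι κ ℝ) (J : Finset κ) (x : κ → ℝ) :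
    B.submatrix id (fun j : {j // j ∈ J} => (j : κ)) *ᵥ (fun j => x j) =
      B *ᵥ (J : Set κ).indicator x := by
  classical
  ext i
  simp only [mulVec, dotProduct, submatrix_apply, id]
  rw [Finset.sum_coe_sort J (fun j => B i j * x j)]
  simp [Set.indicator_apply, Finset.sum_ite_mem]

/-- The eigenvalues of a matrix are bounded by its operator norm. -/
lemma abs_le_opNormR_of_mulVec_eq_smul {ι : Type*} [Fintype ι] {B : Matrix ι ι ℝ}
    {v : ι → ℝ} {μ : ℝ} (hμ : B *ᵥ v = μ • v) (hv : norm2R v = 1) : |μ| ≤ opNormR B := by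
  simpa [hμ, norm2R_smul, hv] using norm2R_mulVec_le_opNormR_mul B v

/-- If a unit eigenvector of `B` has small norm on `I` and `l` is close to its eigenvalue, then
the columns of `B - l` outside `I` form an almost singular matrix. -/
lemma sMinR_shiftMatrixR_compl_le {n : ℕ} {B : Matrix (Fin n) (Fin n) ℝ} {v : Fin n → ℝ}
    {μ l R δ : ℝ} {I : Finset (Fin n)} (hδ : δ ≤ 1 / 2) (hB : opNormR B ≤ R)
    (hμ : B *ᵥ v = μ • v) (hv : norm2R v = 1) (hI : norm2ROn v I ≤ δ) (hl : |μ - l| ≤ δ * R) :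
    sMinR ((shiftMatrixR B l).submatrix id (fun j : {j : Fin n // j ∈ Iᶜ} => (j : Fin n))) ≤
      6 * δ * R := by
  set u := (I : Set (Fin n)).indicator v with hu
  set w := ((Iᶜ : Finset (Fin n)) : Set (Fin n)).indicator v with hw
  have huw : u + w = v := by
    rw [hu, hw, Finset.coe_compl, Set.indicator_self_add_compl]
  have hnu : norm2R u ≤ δ := (norm2R_indicator v I).trans_le hI
  have hnu0 := norm2R_nonneg u
  have hμR : |μ| ≤ R := (abs_le_opNormR_of_mulVec_eq_smul hμ hv).trans hB
  have hR : 0 ≤ R := (abs_nonneg μ).trans hμR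
  have hδ0 : 0 ≤ δ := hnu0.trans hnu
  have hnw : 1 / 2 ≤ norm2R w := by
    have := norm2R_add_le u w
    rw [huw, hv] at this
    linarith
  have hnw1 : norm2R w ≤ 1 := by
    rw [hw, norm2R_indicator, ← hv]
    exact Real.sqrt_le_sqrt (Finset.sum_le_univ_sum_of_nonneg fun i => sq_nonneg _)
  have key := sMinR_mul_norm2R_le
    ((shiftMatrixR B l).submatrix id (fun j : {j : Fin n // j ∈ Iᶜ} => (j : Fin n)))
    (fun j => v j)
  rw [submatrix_coe_mulVec, norm2R_comp_coe, ← norm2R_indicator, ← hw,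
    shiftMatrixR_mulVec] at key
  have hdecomp : B *ᵥ w - l • w = (μ - l) • w + (μ • u + (-1 : ℝ) • (B *ᵥ u)) := by
    have hBw : B *ᵥ w = μ • u + μ • w - B *ᵥ u := by
      rw [← smul_add, huw, ← hμ, ← mulVec_sub, ← huw, add_sub_cancel_left]
    rw [hBw]
    module
  have hbound : norm2R (B *ᵥ w - l • w) ≤ 3 * δ * R := by
    rw [hdecomp]
    have h1 := norm2R_add_le ((μ - l) • w) (μ • u + (-1 : ℝ) • (B *ᵥ u))
    have h2 := norm2R_add_le (μ • u) ((-1 : ℝ) • (B *ᵥ u))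
    simp only [norm2R_smul, abs_neg, abs_one, one_mul] at h1 h2
    have h3 : norm2R (B *ᵥ u) ≤ R * δ :=
      (norm2R_mulVec_le_opNormR_mul B u).trans (mul_le_mul hB hnu hnu0 hR)
    have h4 : |μ| * norm2R u ≤ R * δ := mul_le_mul hμR hnu hnu0 hR
    have h5 : |μ - l| * norm2R w ≤ δ * R * 1 :=
      mul_le_mul hl hnw1 (norm2R_nonneg w) (by positivity)
    linarith
  by_contra! hlt
  have h1 := mul_lt_mul_of_pos_right hlt (one_half_pos.trans_le hnw)
  have h2 : 6 * δ * R * (1 / 2) ≤ 6 * δ * R * norm2R w := by gcongr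
  linarith

/-- A grid of mesh `δ * R` approximates every point of `[-R, R]` from below. -/
lemma exists_grid_point {μ R δ : ℝ} (hR : 0 < R) (hδ : 0 < δ) (hμ : |μ| ≤ R) :
    ∃ k ∈ Finset.range (⌊2 / δ⌋₊ + 1), |μ - (-R + k * (δ * R))| ≤ δ * R := by
  have hδR : 0 < δ * R := mul_pos hδ hR
  obtain ⟨h1, h2⟩ := abs_le.1 hμ
  have hx : 0 ≤ (μ + R) / (δ * R) := div_nonneg (by linarith) hδR.le
  refine ⟨⌊(μ + R) / (δ * R)⌋₊, ?_, ?_⟩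
  · rw [Finset.mem_range, Nat.lt_succ_iff]
    refine Nat.floor_le_floor ?_
    rw [div_le_div_iff₀ hδR hδ]
    nlinarith
  · have h3 := (le_div_iff₀ hδR).1 (Nat.floor_le hx)
    have h4 := (div_lt_iff₀ hδR).1 (Nat.lt_floor_add_one ((μ + R) / (δ * R)))
    rw [abs_le]
    constructor <;> linarith

lemma abs_grid_point_le {R δ : ℝ} (hR : 0 ≤ R) (hδ : 0 < δ) {k : ℕ}
    (hk : k ∈ Finset.range (⌊2 / δ⌋₊ + 1)) : |-R + k * (δ * R)| ≤ R := by
  rw [Finset.mem_range, Nat.lt_succ_iff, Nat.le_floor_iff (by positivity), le_div_iff₀ hδ] at hk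
  have h1 : (k * δ) * R ≤ 2 * R := mul_le_mul_of_nonneg_right hk hR
  have h2 : 0 ≤ (k * δ) * R := by positivity
  rw [abs_le]
  constructor <;> linarith

lemma Nat.choose_le_mul_exp_div_pow (n : ℕ) {m : ℕ} (hm : m ≠ 0) :
    (n.choose m : ℝ) ≤ ((n : ℝ) * Real.exp 1 / m) ^ m := by
  have hm' : (0 : ℝ) < m := by positivity
  have hfact : (m : ℝ) ^ m / m.factorial ≤ Real.exp 1 ^ m := by
    rw [← Real.exp_nat_mul, mul_one]
    exact Real.pow_div_factorial_le_exp (m : ℝ) hm'.le m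
  calc (n.choose m : ℝ) ≤ (n : ℝ) ^ m / m.factorial := Nat.choose_le_pow_div m n
    _ = (n / m : ℝ) ^ m * ((m : ℝ) ^ m / m.factorial) := by
        rw [div_pow]
        field_simp
    _ ≤ (n / m : ℝ) ^ m * Real.exp 1 ^ m := by gcongr
    _ = ((n : ℝ) * Real.exp 1 / m) ^ m := by rw [← mul_pow, div_mul_eq_mul_div]

/-- Proposition 3.3 (reduction of delocalization to invertibility for real eigenvectors):
if for every `I` of size `m` and every real `λ₀` with `|λ₀| ≤ M√n` the probability that
`s_min((A-λ₀·Id)_{I^c}) ≤ 6δM√n` and `‖A‖ ≤ M√n` is at most `p₀`, then the probability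
that `‖A‖ ≤ M√n` and some unit real eigenvector `v` of `A` has `‖v_I‖₂ < δ` for some `I`
of size `m` is at most `(3/δ)(ne/m)^m p₀`. -/
theorem reduction_delocalization_invertibility_real_eigenvectors
    (n : ℕ) (Ω : Type) [MeasureSpace Ω] [IsProbabilityMeasure (ℙ : Measure Ω)]
    (A : Ω → Matrix (Fin n) (Fin n) ℝ)
    (M δ p₀ : ℝ) (hM : 1 ≤ M) (hδ : δ ∈ Set.Ioo (0 : ℝ) (1 / 2))
    (hp₀ : p₀ ∈ Set.Ioo (0 : ℝ) 1)
    (m : ℕ) (hm : 1 ≤ m) (hmn : m ≤ n)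
    (h : ∀ I : Finset (Fin n), I.card = m →
      ∀ l : ℝ, |l| ≤ M * Real.sqrt n →
      ℙ {ω | sMinR ((shiftMatrixR (A ω) l).submatrix id
              (fun j : {j : Fin n // j ∈ Iᶜ} => (j : Fin n))) ≤ 6 * δ * M * Real.sqrt n ∧
            opNormR (A ω) ≤ M * Real.sqrt n} ≤ ENNReal.ofReal p₀) :
    ℙ {ω | opNormR (A ω) ≤ M * Real.sqrt n ∧
        ∃ (v : Fin n → ℝ) (μ : ℝ), v ≠ 0 ∧ A ω *ᵥ v = μ • v ∧ norm2R v = 1 ∧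
          ∃ I : Finset (Fin n), I.card = m ∧ norm2ROn v I < δ} ≤
      ENNReal.ofReal (3 / δ * ((n : ℝ) * Real.exp 1 / m) ^ m * p₀) := by
  obtain ⟨hδ0, hδ1⟩ := hδ
  have hn : (0 : ℝ) < n := by exact_mod_cast hm.trans hmn
  have hR : 0 < M * Real.sqrt n := by positivity
  set R := M * Real.sqrt n with hRdef
  set S := Finset.powersetCard m (Finset.univ : Finset (Fin n)) ×ˢ Finset.range (⌊2 / δ⌋₊ + 1)
  set E : Finset (Fin n) × ℕ → Set Ω := fun q =>
    {ω | sMinR ((shiftMatrixR (A ω) (-R + q.2 * (δ * R))).submatrix id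
          (fun j : {j : Fin n // j ∈ q.1ᶜ} => (j : Fin n))) ≤ 6 * δ * M * Real.sqrt n ∧
        opNormR (A ω) ≤ R}
  have hcover : {ω | opNormR (A ω) ≤ R ∧
      ∃ (v : Fin n → ℝ) (μ : ℝ), v ≠ 0 ∧ A ω *ᵥ v = μ • v ∧ norm2R v = 1 ∧
        ∃ I : Finset (Fin n), I.card = m ∧ norm2ROn v I < δ} ⊆ ⋃ q ∈ S, E q := by
    rintro ω ⟨hA, v, μ, -, hμ, hv, I, hIm, hI⟩
    obtain ⟨k, hk, hkμ⟩ :=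
      exists_grid_point hR hδ0 ((abs_le_opNormR_of_mulVec_eq_smul hμ hv).trans hA)
    refine Set.mem_iUnion₂.2 ⟨(I, k), Finset.mem_product.2
      ⟨Finset.mem_powersetCard.2 ⟨Finset.subset_univ I, hIm⟩, hk⟩, ?_, hA⟩
    rw [mul_assoc (6 * δ)]
    exact sMinR_shiftMatrixR_compl_le hδ1.le hA hμ hv hI.le hkμ
  have hE : ∀ q ∈ S, ℙ (E q) ≤ ENNReal.ofReal p₀ := fun q hq =>
    h q.1 (Finset.mem_powersetCard.1 (Finset.mem_product.1 hq).1).2 _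
      (abs_grid_point_le hR.le hδ0 (Finset.mem_product.1 hq).2)
  have hcard : (S.card : ℝ) ≤ 3 / δ * ((n : ℝ) * Real.exp 1 / m) ^ m := by
    rw [Finset.card_product, Finset.card_powersetCard, Finset.card_univ, Fintype.card_fin,
      Finset.card_range, mul_comm, Nat.cast_mul]
    have hgrid : ((⌊2 / δ⌋₊ + 1 : ℕ) : ℝ) ≤ 3 / δ := by
      have h1 : (⌊2 / δ⌋₊ : ℝ) ≤ 2 / δ := Nat.floor_le (by positivity)
      have h2 : 1 ≤ 1 / δ := by
        rw [le_div_iff₀ hδ0]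
        linarith
      have h3 : 3 / δ = 2 / δ + 1 / δ := by ring
      push_cast
      linarith
    exact mul_le_mul hgrid (Nat.choose_le_mul_exp_div_pow n (by omega)) (by positivity)
      (by positivity)
  calc _ ≤ ℙ (⋃ q ∈ S, E q) := measure_mono hcover
    _ ≤ ∑ q ∈ S, ℙ (E q) := measure_biUnion_finset_le S E
    _ ≤ ∑ _q ∈ S, ENNReal.ofReal p₀ := Finset.sum_le_sum hE
    _ = ENNReal.ofReal (S.card * p₀) := by
        rw [Finset.sum_const, nsmul_eq_mul, ENNReal.ofReal_mul (Nat.cast_nonneg _),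
          ENNReal.ofReal_natCast]
    _ ≤ _ := ENNReal.ofReal_le_ofReal (mul_le_mul_of_nonneg_right hcard hp₀.1.le)
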